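/- Let A be a C*-algebra and (m_n) a sequence of multipliers of A such that the partial sums ∑_{n=1}^N m_n* m_n are uniformly bounded in norm by a constant C, and such that for each a ∈ A the series ∑_n a* m_n* m_n a converges in norm. Then for each a ∈ A the series ∑_n m_n* m_n a converges in norm, with the estimate ‖∑_{n=N}^{M} m_n* m_n a‖ ≤ C^{1/2} · ‖∑_{n=N}^{M} a* m_n* m_n a‖^{1/2}. -/

import Mathlib

open Filter MultiplierAlgebra
open scoped MultiplierAlgebra

/-- Cauchy–Schwarz for a positive element of a C*-algebra. -/
theorem CStarAlgebra.norm_mul_le_sqrt_mul_sqrt_of_nonneg {B : Type*} [CStarAlgebra B]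
    [PartialOrder B] [StarOrderedRing B] {t : B} (ht : 0 ≤ t) (b : B) :
    ‖t * b‖ ≤ √‖t‖ * √‖star b * (t * b)‖ := by
  obtain ⟨s, rfl⟩ := CStarAlgebra.nonneg_iff_eq_star_mul_self.mp ht
  have h : star b * (star s * s * b) = star (s * b) * (s * b) := by
    simp only [star_mul, mul_assoc]
  rw [h, CStarRing.norm_star_mul_self, CStarRing.norm_star_mul_self,
    Real.sqrt_mul_self (norm_nonneg _), Real.sqrt_mul_self (norm_nonneg _), mul_assoc]
  simpa using norm_mul_le (star s) (s * b)

/-- The norm of a finite sum of elements `star (x n) * x n` is monotone in the index set. -/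
theorem CStarAlgebra.norm_sum_star_mul_self_mono {ι B : Type*} [CStarAlgebra B]
    [PartialOrder B] [StarOrderedRing B] (x : ι → B) {s t : Finset ι} (hst : s ⊆ t) :
    ‖∑ n ∈ s, star (x n) * x n‖ ≤ ‖∑ n ∈ t, star (x n) * x n‖ :=
  CStarAlgebra.norm_le_norm_of_nonneg_of_le
    (Finset.sum_nonneg fun n _ => star_mul_self_nonneg (x n))
    (Finset.sum_le_sum_of_subset_of_nonneg hst fun n _ _ => star_mul_self_nonneg (x n))

namespace DoubleCentralizer

variable {A : Type*} [NonUnitalCStarAlgebra A]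

theorem norm_coe (a : A) : ‖(a : 𝓜(ℂ, A))‖ = ‖a‖ := by
  rw [← norm_fst, coe_fst, ContinuousLinearMap.opNorm_mul_apply]

/-- The left action of a multiplier commutes with right multiplication. -/
theorem fst_mul (T : 𝓜(ℂ, A)) (a b : A) : T.fst (a * b) = T.fst a * b := by
  have h (y : A) : y * (T.fst (a * b) - T.fst a * b) = 0 := by
    rw [mul_sub, ← T.central, ← mul_assoc y, ← T.central, mul_assoc, sub_self]
  exact sub_eq_zero.mp (CStarRing.star_mul_self_eq_zero_iff _ |>.mp (h _))

theorem mul_coe (T : 𝓜(ℂ, A)) (a : A) : T * (a : 𝓜(ℂ, A)) = (T.fst a : A) := by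
  refine DoubleCentralizer.ext ℂ A _ _ (Prod.ext ?_ ?_)
  · exact ContinuousLinearMap.ext fun x => fst_mul T a x
  · exact ContinuousLinearMap.ext fun x => T.central x a

theorem star_coe_mul_coe (a b : A) :
    star (a : 𝓜(ℂ, A)) * (b : 𝓜(ℂ, A)) = (star a * b : A) := by
  simpa only [map_star, coeHom_apply] using
    (map_mul (coeHom (𝕜 := ℂ) (A := A)) (star a) b).symm

theorem sum_fst_apply {ι : Type*} (s : Finset ι) (T : ι → 𝓜(ℂ, A)) (a : A) :
    (∑ n ∈ s, T n).fst a = ∑ n ∈ s, (T n).fst a := by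
  classical
  induction s using Finset.induction_on with
  | empty => simp
  | insert i s hi ih => simp [Finset.sum_insert hi, ih]

/-- Cauchy–Schwarz for a finite sum `∑ star (m n) * m n` of multipliers acting on `A`. -/
theorem norm_sum_star_mul_self_fst_le {ι : Type*} (m : ι → 𝓜(ℂ, A)) (s : Finset ι) (a : A) :
    ‖∑ n ∈ s, (star (m n) * m n).fst a‖ ≤ √‖∑ n ∈ s, star (m n) * m n‖ *
      √‖∑ n ∈ s, star a * (star (m n) * m n).fst a‖ := by
  let _ := CStarAlgebra.spectralOrder 𝓜(ℂ, A)
  have := CStarAlgebra.spectralOrderedRing 𝓜(ℂ, A)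
  have h := CStarAlgebra.norm_mul_le_sqrt_mul_sqrt_of_nonneg
    (Finset.sum_nonneg fun n (_ : n ∈ s) => star_mul_self_nonneg (m n)) (a : 𝓜(ℂ, A))
  rwa [mul_coe, star_coe_mul_coe, norm_coe, norm_coe, sum_fst_apply, Finset.mul_sum] at h

end DoubleCentralizer

/-- If `(m_n)` are multipliers of a C*-algebra `A` with partial sums
`∑ m_n* m_n` uniformly bounded by `C` and, for each `a ∈ A`, the series
`∑ a* m_n* m_n a` norm-convergent, then `∑ m_n* m_n a` converges in norm for each `a`,
with `‖∑_{n=N}^{M} m_n* m_n a‖ ≤ C^{1/2} ‖∑_{n=N}^{M} a* m_n* m_n a‖^{1/2}`. -/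
theorem statement11 {A : Type*} [NonUnitalCStarAlgebra A]
    (m : ℕ → 𝓜(ℂ, A)) (C : ℝ)
    (hC : ∀ N : ℕ, ‖∑ n ∈ Finset.range N, star (m n) * m n‖ ≤ C)
    (hconv : ∀ a : A, ∃ s : A,
      Tendsto (fun N : ℕ => ∑ n ∈ Finset.range N, star a * ((star (m n) * m n).fst a))
        atTop (nhds s)) :
    (∀ a : A, ∃ s : A,
      Tendsto (fun N : ℕ => ∑ n ∈ Finset.range N, (star (m n) * m n).fst a)
        atTop (nhds s)) ∧
    (∀ (a : A) (N M : ℕ),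
      ‖∑ n ∈ Finset.Icc N M, (star (m n) * m n).fst a‖
        ≤ Real.sqrt C * Real.sqrt ‖∑ n ∈ Finset.Icc N M, star a * ((star (m n) * m n).fst a)‖) := by
  have key (a : A) (M : ℕ) (s : Finset ℕ) (hs : s ⊆ Finset.range M) :
      ‖∑ n ∈ s, (star (m n) * m n).fst a‖
        ≤ √C * √‖∑ n ∈ s, star a * ((star (m n) * m n).fst a)‖ := by
    let _ := CStarAlgebra.spectralOrder 𝓜(ℂ, A)
    have := CStarAlgebra.spectralOrderedRing 𝓜(ℂ, A)
    refine (DoubleCentralizer.norm_sum_star_mul_self_fst_le m s a).trans ?_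
    gcongr
    exact (CStarAlgebra.norm_sum_star_mul_self_mono m hs).trans (hC M)
  refine ⟨fun a => ?_, fun a N M => key a (M + 1) _ fun n hn => ?_⟩
  · obtain ⟨s, hs⟩ := hconv a
    refine cauchySeq_tendsto_of_complete (Metric.cauchySeq_iff'.mpr fun ε hε => ?_)
    have hlim : Tendsto (fun x : ℝ => √C * √x) (nhds 0) (nhds 0) := by
      have : Continuous fun x : ℝ => √C * √x := by fun_prop
      simpa using this.tendsto 0
    obtain ⟨δ, hδ, hδε⟩ := Metric.eventually_nhds_iff.mp (hlim.eventually_lt_const hε)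
    obtain ⟨N, hN⟩ := Metric.cauchySeq_iff'.mp hs.cauchySeq δ hδ
    refine ⟨N, fun n hn => ?_⟩
    have hNn := hN n hn
    rw [dist_eq_norm, ← Finset.sum_Ico_eq_sub _ hn] at hNn ⊢
    refine (key a n _ fun k hk => ?_).trans_lt (hδε (by simpa using hNn))
    exact Finset.mem_range.mpr (Finset.mem_Ico.mp hk).2
  · exact Finset.mem_range.mpr (Nat.lt_succ_of_le (Finset.mem_Icc.mp hn).2)
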